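/- arXiv:1207.2949 — 5 statements merged into one kernel-verified Lean document; each statement's English description precedes it below -/
import Mathlib

section
/- Let h ≥ 1 and let α₁, …, α_{2h+2} be distinct complex numbers. Let a, b, c, d be complex numbers with ad − bc ≠ 0 and such that c·α_r + d ≠ 0 for every index r, and set β_r = (a·α_r + b)/(c·α_r + d) for each r. Then for every pair of distinct indices i, j one has δ_{ij}(β₁, …, β_{2h+2}) = δ_{ij}(α₁, …, α_{2h+2}); that is, the quantity δ_{ij} is invariant under the action of Möbius transformations on the points α₁, …, α_{2h+2}. -/
open Finset

/-- The modular invariant `δ_{ij}` attached to `2h+2` points `α` and a pair of indices `i, j`: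
`δ_{ij} = (α_i − α_j)^{2h(2h+1)} · ∏_{r≠s} (α_r − α_s) /
          ( ∏_{r≠i} (α_i − α_r)^{2h+1} · ∏_{r≠j} (α_j − α_r)^{2h+1} )`. -/
noncomputable def delta (h : ℕ) (α : Fin (2 * h + 2) → ℂ) (i j : Fin (2 * h + 2)) : ℂ :=
  ((α i - α j) ^ (2 * h * (2 * h + 1)) *
      ∏ r : Fin (2 * h + 2), ∏ s ∈ Finset.univ.filter (fun s => s ≠ r), (α r - α s)) /
    ((∏ r ∈ Finset.univ.filter (fun r => r ≠ i), (α i - α r) ^ (2 * h + 1)) *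
      (∏ r ∈ Finset.univ.filter (fun r => r ≠ j), (α j - α r) ^ (2 * h + 1)))

/-- The identity `∏_{s ≠ r} w_r w_s = w_r^{2h} ∏_s w_s` underlying the behaviour of a row product
of differences when each difference `α_r − α_s` is multiplied by `D w_r w_s`. -/
theorem prod_ne_sub_of_sub_eq_mul {h : ℕ} {α β w : Fin (2 * h + 2) → ℂ} {D : ℂ}
    (hβ : ∀ r s, β r - β s = D * (w r * w s) * (α r - α s)) (r : Fin (2 * h + 2)) :
    ∏ s ∈ univ.filter (fun s => s ≠ r), (β r - β s) =
      D ^ (2 * h + 1) * (w r ^ (2 * h) * ∏ s, w s) *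
        ∏ s ∈ univ.filter (fun s => s ≠ r), (α r - α s) := by
  have hcard : (univ.filter (fun s => s ≠ r)).card = 2 * h + 1 := by
    simp [filter_ne']
  have hprod : ∏ s, w s = w r * ∏ s ∈ univ.filter (fun s => s ≠ r), w s := by
    rw [filter_ne', mul_prod_erase _ _ (mem_univ r)]
  simp only [hβ r, prod_mul_distrib, prod_const, hcard, hprod]
  ring

/-- `δ_{ij}` is unchanged when each difference `α_r − α_s` is multiplied by `D w_r w_s`. -/
theorem delta_eq_of_sub_eq_mul {h : ℕ} {α β w : Fin (2 * h + 2) → ℂ} {D : ℂ} (hD : D ≠ 0)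
    (hw : ∀ r, w r ≠ 0) (hβ : ∀ r s, β r - β s = D * (w r * w s) * (α r - α s))
    (i j : Fin (2 * h + 2)) : delta h β i j = delta h α i j := by
  have hW : ∏ r, w r ≠ 0 := prod_ne_zero_iff.mpr fun r _ => hw r
  have hk : D ^ (2 * (2 * h + 1) ^ 2) * (w i * w j) ^ (2 * h * (2 * h + 1)) *
      (∏ r, w r) ^ (2 * (2 * h + 1)) ≠ 0 :=
    mul_ne_zero (mul_ne_zero (pow_ne_zero _ hD) (pow_ne_zero _ (mul_ne_zero (hw i) (hw j))))
      (pow_ne_zero _ hW)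
  simp only [delta, prod_pow, prod_ne_sub_of_sub_eq_mul hβ]
  refine Eq.trans ?_ (mul_div_mul_left _ _ hk)
  congr 1
  · simp only [hβ i j, prod_mul_distrib, prod_const, prod_pow, card_univ, Fintype.card_fin, mul_pow]
    ring
  · ring

/-- `δ_{ij}` is invariant under Möbius transformations of the points `α`. -/
theorem delta_moebius_invariant (h : ℕ) (hh : 1 ≤ h)
    (α : Fin (2 * h + 2) → ℂ) (hα : Function.Injective α)
    (a b c d : ℂ) (habcd : a * d - b * c ≠ 0) (hcd : ∀ r, c * α r + d ≠ 0)
    (β : Fin (2 * h + 2) → ℂ) (hβ : ∀ r, β r = (a * α r + b) / (c * α r + d))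
    (i j : Fin (2 * h + 2)) (hij : i ≠ j) :
    delta h β i j = delta h α i j := by
  refine delta_eq_of_sub_eq_mul (w := fun r => (c * α r + d)⁻¹) habcd
    (fun r => inv_ne_zero (hcd r)) (fun r s => ?_) i j
  rw [hβ r, hβ s, div_sub_div _ _ (hcd r) (hcd s), ← mul_inv, mul_right_comm, ← div_eq_mul_inv]
  congr 1
  ring
end

section
/- Let h ≥ 1 and let α₁, …, α_{2h+2} be distinct complex numbers. For distinct indices i, j, k set η_{ijk} = δ_{ik} · δ_{jk}^{−1}. Then for every pair of distinct indices i, j, the product ∏_{k≠i,j} η_{ijk}, taken over all indices k distinct from both i and j, is equal to 1; in particular ∑_{k≠i,j} log |η_{ijk}| = 0. -/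
open Finset

theorem prod_sub_ne_zero {ι R : Type*} [Fintype ι] [DecidableEq ι] [CommRing R] [IsDomain R]
    {α : ι → R} (hα : Function.Injective α) (i : ι) :
    ∏ r ∈ Finset.univ.filter (fun r => r ≠ i), (α i - α r) ≠ 0 :=
  Finset.prod_ne_zero_iff.2 fun r hr =>
    sub_ne_zero.2 (hα.ne (by simpa using (Finset.mem_filter.1 hr).2.symm))

theorem prod_sub_eq_mul {ι R : Type*} [Fintype ι] [DecidableEq ι] [CommRing R]
    (α : ι → R) {i j : ι} (hij : i ≠ j) :
    ∏ r ∈ Finset.univ.filter (fun r => r ≠ i), (α i - α r) =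
      (α i - α j) * ∏ r ∈ Finset.univ.filter (fun r => r ≠ i ∧ r ≠ j), (α i - α r) := by
  rw [← Finset.mul_prod_erase _ _ (Finset.mem_filter.2 ⟨Finset.mem_univ j, hij.symm⟩)]
  congr 2
  ext r
  simp [and_comm]

theorem card_filter_ne_and_ne {ι : Type*} [Fintype ι] [DecidableEq ι] {i j : ι} (hij : i ≠ j) :
    (Finset.univ.filter (fun k => k ≠ i ∧ k ≠ j)).card = Fintype.card ι - 2 := by
  have : Finset.univ.filter (fun k => k ≠ i ∧ k ≠ j) = ({i, j} : Finset ι)ᶜ := by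
    ext r
    simp
  rw [this, Finset.card_compl, Finset.card_pair hij]

/-- In `δ_{ik} δ_{jk}⁻¹` the discriminant and the factors attached to `k` cancel. -/
theorem delta_mul_inv_delta (h : ℕ) {α : Fin (2 * h + 2) → ℂ} (hα : Function.Injective α)
    (i j : Fin (2 * h + 2)) {k : Fin (2 * h + 2)} (hkj : k ≠ j) :
    delta h α i k * (delta h α j k)⁻¹ =
      ((α i - α k) / (α j - α k)) ^ (2 * h * (2 * h + 1)) *
        ((∏ r ∈ Finset.univ.filter (fun r => r ≠ j), (α j - α r)) /
          ∏ r ∈ Finset.univ.filter (fun r => r ≠ i), (α i - α r)) ^ (2 * h + 1) := by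
  have hD : ∏ r : Fin (2 * h + 2), ∏ s ∈ Finset.univ.filter (fun s => s ≠ r), (α r - α s) ≠ 0 :=
    Finset.prod_ne_zero_iff.2 fun r _ => prod_sub_ne_zero hα r
  have hi := prod_sub_ne_zero hα i
  have hj := prod_sub_ne_zero hα j
  have hk := prod_sub_ne_zero hα k
  have hjk : α j - α k ≠ 0 := sub_ne_zero.2 (hα.ne hkj.symm)
  simp only [delta, Finset.prod_pow, div_pow]
  field_simp

/-- With `η_{ijk} = δ_{ik} δ_{jk}^{-1}`, the product `∏_{k≠i,j} η_{ijk}` equals `1`;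
in particular `∑_{k≠i,j} log |η_{ijk}| = 0`. -/
theorem prod_eta_eq_one (h : ℕ) (hh : 1 ≤ h)
    (α : Fin (2 * h + 2) → ℂ) (hα : Function.Injective α)
    (i j : Fin (2 * h + 2)) (hij : i ≠ j) :
    (∏ k ∈ Finset.univ.filter (fun k => k ≠ i ∧ k ≠ j),
        delta h α i k * (delta h α j k)⁻¹) = 1 ∧
      (∑ k ∈ Finset.univ.filter (fun k => k ≠ i ∧ k ≠ j),
        Real.log ‖delta h α i k * (delta h α j k)⁻¹‖) = 0 := by
  have hprod : (∏ k ∈ Finset.univ.filter (fun k => k ≠ i ∧ k ≠ j),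
      delta h α i k * (delta h α j k)⁻¹) = 1 := by
    rw [Finset.prod_congr rfl fun k hk =>
      delta_mul_inv_delta h hα i j (Finset.mem_filter.1 hk).2.2]
    have hi := prod_sub_ne_zero hα i
    have hj := prod_sub_ne_zero hα j
    have hsymm : Finset.univ.filter (fun k => k ≠ j ∧ k ≠ i) =
        Finset.univ.filter (fun k => k ≠ i ∧ k ≠ j) := by
      simp only [and_comm]
    rw [Finset.prod_mul_distrib, Finset.prod_pow, Finset.prod_const, card_filter_ne_and_ne hij,
      Fintype.card_fin, Nat.add_sub_cancel, ← pow_mul, mul_comm (2 * h + 1), ← mul_pow,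
      Finset.prod_div_distrib]
    rw [prod_sub_eq_mul α hij] at hi ⊢
    rw [prod_sub_eq_mul α hij.symm, hsymm] at hj ⊢
    obtain ⟨hij', hQi⟩ := mul_ne_zero_iff.1 hi
    have hQj := (mul_ne_zero_iff.1 hj).2
    rw [mul_assoc 2 h, pow_mul]
    convert one_pow _ using 2
    rw [← neg_sub (α i) (α j)]
    field_simp
  refine ⟨hprod, ?_⟩
  have hne := Finset.prod_ne_zero_iff.1 (hprod.trans_ne one_ne_zero)
  rw [← Real.log_prod fun k hk => norm_ne_zero_iff.2 (hne k hk), ← norm_prod, hprod, norm_one,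
    Real.log_one]
end

section
/- Let h ≥ 1, let α₁, …, α_{2h+2} be distinct complex numbers, and let G be a real-valued function on pairs of distinct indices from {1, …, 2h+2} such that: (a) G(i,j) = G(j,i) for all distinct i, j (symmetry); (b) for all four distinct indices i, j, k, r one has G(i,k) − G(i,r) − G(j,k) + G(j,r) = (1/(4h(2h+1))) · log |δ_{ik} · δ_{jk}^{−1} · δ_{jr} · δ_{ir}^{−1}|; and (c) the row sums ∑_{k≠i} G(i,k) are equal for all indices i. Define ψ = (1/(2h+2)) · ∑_{i≠j} G(i,j), the sum running over all ordered pairs of distinct indices. Then for every pair of distinct indices i, j one has G(i,j) = (1/(4h(2h+1))) · log |δ_{ij}| + (1/(2h+1)) · ψ. (This is the content of Theorem A: for the canonical Green's function g_μ of a hyperelliptic Riemann surface of genus h evaluated at pairs of Weierstrass points, hypotheses (a), (b), (c) hold and the conclusion reads g_μ(w_i,w_j) = (1/(4h(2h+1))) log |δ_{ij}| + (1/(2h+1)) ψ(M).) -/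
open Finset

/-- A symmetric function on pairs of distinct indices whose second differences vanish and whose
row sums all equal `R` is constant, and its value is `R / (card ι - 1)`. -/
theorem card_sub_one_mul_eq_of_second_difference_eq_zero {ι : Type*} [Fintype ι] [DecidableEq ι]
    (F : ι → ι → ℝ) (R : ℝ) (hcard : 3 ≤ Fintype.card ι)
    (hsym : ∀ i j, i ≠ j → F i j = F j i)
    (hcross : ∀ i j k r, i ≠ j → i ≠ k → i ≠ r → j ≠ k → j ≠ r → k ≠ r →
      F i k - F i r - F j k + F j r = 0)
    (hrow : ∀ i, ∑ k ∈ univ.filter (fun k => k ≠ i), F i k = R)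
    (i j : ι) (hij : i ≠ j) :
    ((Fintype.card ι : ℝ) - 1) * F i j = R := by
  have filter_eq (i : ι) : univ.filter (fun k => k ≠ i) = univ.erase i := by
    ext; simp
  simp only [filter_eq] at hrow
  have column_eq (i j k : ι) (hij : i ≠ j) (hik : i ≠ k) (hjk : j ≠ k) : F i k = F j k := by
    have hi := hrow i
    have hj := hrow j
    rw [← add_sum_erase _ _ (show j ∈ univ.erase i by simp [hij.symm])] at hi
    rw [← add_sum_erase _ _ (show i ∈ univ.erase j by simp [hij]), erase_right_comm] at hj
    have hsum : ∑ r ∈ (univ.erase i).erase j, (F i r - F j r) = 0 := by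
      rw [sum_sub_distrib]
      linarith [hsym i j hij]
    have hconst : ∀ r ∈ (univ.erase i).erase j, F i r - F j r = F i k - F j k := by
      intro r hr
      simp only [mem_erase, mem_univ, and_true] at hr
      rcases eq_or_ne k r with rfl | hkr
      · rfl
      · linarith [hcross i j k r hij hik hr.2.symm hjk hr.1.symm hkr]
    rw [sum_congr rfl hconst, sum_const, nsmul_eq_mul] at hsum
    have hne : ((((univ : Finset ι).erase i).erase j).card : ℝ) ≠ 0 := by
      rw [Nat.cast_ne_zero]
      exact card_ne_zero_of_mem (show k ∈ _ by simp [hik.symm, hjk.symm])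
    linarith [(mul_eq_zero.mp hsum).resolve_left hne]
  have hrow_const : ∀ k ∈ univ.erase i, F i k = F i j := by
    intro k hk
    have hki : k ≠ i := by simpa using hk
    rcases eq_or_ne k j with rfl | hkj
    · rfl
    · rw [hsym i k hki.symm, hsym i j hij, column_eq k j i hkj hki hij.symm]
  have hi := hrow i
  rw [sum_congr rfl hrow_const, sum_const, nsmul_eq_mul, card_erase_of_mem (mem_univ i),
    card_univ, Nat.cast_sub (by lia), Nat.cast_one] at hi
  exact hi

theorem delta_ne_zero (h : ℕ) (α : Fin (2 * h + 2) → ℂ) (hα : Function.Injective α)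
    (i j : Fin (2 * h + 2)) (hij : i ≠ j) : delta h α i j ≠ 0 := by
  have hne (r s : Fin (2 * h + 2)) (hrs : r ≠ s) : α r - α s ≠ 0 :=
    sub_ne_zero.mpr (hα.ne hrs)
  have hprod (r : Fin (2 * h + 2)) :
      ∏ s ∈ univ.filter (fun s => s ≠ r), (α r - α s) ≠ 0 :=
    prod_ne_zero_iff.mpr fun s hs => hne r s (by simpa using Ne.symm (mem_filter.mp hs).2)
  unfold delta
  simp only [prod_pow]
  exact div_ne_zero
    (mul_ne_zero (pow_ne_zero _ (hne i j hij)) (prod_ne_zero_iff.mpr fun r _ => hprod r))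
    (mul_ne_zero (pow_ne_zero _ (hprod i)) (pow_ne_zero _ (hprod j)))

theorem log_norm_delta (h : ℕ) (α : Fin (2 * h + 2) → ℂ) (hα : Function.Injective α)
    (i j : Fin (2 * h + 2)) (hij : i ≠ j) :
    Real.log ‖delta h α i j‖ =
      2 * h * (2 * h + 1) * Real.log ‖α i - α j‖ +
        ∑ r, ∑ s ∈ univ.filter (fun s => s ≠ r), Real.log ‖α r - α s‖ -
        (2 * h + 1) * ∑ s ∈ univ.filter (fun s => s ≠ i), Real.log ‖α i - α s‖ -
        (2 * h + 1) * ∑ s ∈ univ.filter (fun s => s ≠ j), Real.log ‖α j - α s‖ := by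
  have hne (r s : Fin (2 * h + 2)) (hrs : r ≠ s) : ‖α r - α s‖ ≠ 0 :=
    norm_ne_zero_iff.mpr (sub_ne_zero.mpr (hα.ne hrs))
  have hne' (r s : Fin (2 * h + 2)) (hs : s ∈ univ.filter (fun s => s ≠ r)) :
      ‖α r - α s‖ ≠ 0 := hne r s (Ne.symm (mem_filter.mp hs).2)
  have hprod (r : Fin (2 * h + 2)) :
      ∏ s ∈ univ.filter (fun s => s ≠ r), ‖α r - α s‖ ≠ 0 := prod_ne_zero_iff.mpr (hne' r)
  have hprod' : ∏ r, ∏ s ∈ univ.filter (fun s => s ≠ r), ‖α r - α s‖ ≠ 0 :=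
    prod_ne_zero_iff.mpr fun r _ => hprod r
  have hlog (r : Fin (2 * h + 2)) :
      Real.log (∏ s ∈ univ.filter (fun s => s ≠ r), ‖α r - α s‖) =
        ∑ s ∈ univ.filter (fun s => s ≠ r), Real.log ‖α r - α s‖ := Real.log_prod (hne' r)
  unfold delta
  simp only [prod_pow, norm_div, norm_mul, norm_pow, norm_prod]
  rw [Real.log_div (mul_ne_zero (pow_ne_zero _ (hne i j hij)) hprod')
      (mul_ne_zero (pow_ne_zero _ (hprod i)) (pow_ne_zero _ (hprod j))),
    Real.log_mul (pow_ne_zero _ (hne i j hij)) hprod',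
    Real.log_mul (pow_ne_zero _ (hprod i)) (pow_ne_zero _ (hprod j)),
    Real.log_prod fun r _ => hprod r]
  simp only [Real.log_pow, hlog]
  push_cast
  ring

theorem log_norm_delta_comm (h : ℕ) (α : Fin (2 * h + 2) → ℂ) (hα : Function.Injective α)
    (i j : Fin (2 * h + 2)) (hij : i ≠ j) :
    Real.log ‖delta h α i j‖ = Real.log ‖delta h α j i‖ := by
  rw [log_norm_delta h α hα i j hij, log_norm_delta h α hα j i hij.symm, norm_sub_rev (α i)]
  ring

theorem sum_log_norm_delta (h : ℕ) (α : Fin (2 * h + 2) → ℂ) (hα : Function.Injective α)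
    (i : Fin (2 * h + 2)) :
    ∑ j ∈ univ.filter (fun j => j ≠ i), Real.log ‖delta h α i j‖ = 0 := by
  rw [sum_congr rfl fun j hj => log_norm_delta h α hα i j (Ne.symm (mem_filter.mp hj).2)]
  set S : Fin (2 * h + 2) → ℝ := fun r =>
    ∑ s ∈ univ.filter (fun s => s ≠ r), Real.log ‖α r - α s‖
  have hfilter : univ.filter (fun j => j ≠ i) = univ.erase i := by ext; simp
  have hcard : ((univ.filter (fun j => j ≠ i)).card : ℝ) = 2 * h + 1 := by
    rw [hfilter, card_erase_of_mem (mem_univ i), card_univ, Fintype.card_fin]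
    push_cast [Nat.add_sub_cancel, show 2 * h + 2 - 1 = 2 * h + 1 by lia]
    ring
  have hrest : ∑ j ∈ univ.filter (fun j => j ≠ i), S j = ∑ j, S j - S i := by
    rw [hfilter, sum_erase_eq_sub (mem_univ i)]
  change ∑ j ∈ univ.filter (fun j => j ≠ i),
    (2 * h * (2 * h + 1) * Real.log ‖α i - α j‖ + ∑ r, S r - (2 * h + 1) * S i -
      (2 * h + 1) * S j) = 0
  rw [sum_sub_distrib, sum_sub_distrib, sum_add_distrib, ← mul_sum, ← mul_sum, ← mul_sum, hrest,
    sum_const, sum_const, nsmul_eq_mul, nsmul_eq_mul, hcard]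
  change 2 * h * (2 * h + 1) * S i + _ - _ - _ = 0
  ring

/-- Theorem A: if `G` is symmetric, satisfies the cross-ratio relation (b) and has equal
row sums (c), then `G(i,j) = (1/(4h(2h+1))) log |δ_{ij}| + (1/(2h+1)) ψ`. -/
theorem theoremA (h : ℕ) (hh : 1 ≤ h)
    (α : Fin (2 * h + 2) → ℂ) (hα : Function.Injective α)
    (G : Fin (2 * h + 2) → Fin (2 * h + 2) → ℝ)
    (hsym : ∀ i j, i ≠ j → G i j = G j i)
    (hcross : ∀ i j k r : Fin (2 * h + 2), i ≠ j → i ≠ k → i ≠ r → j ≠ k → j ≠ r → k ≠ r →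
      G i k - G i r - G j k + G j r =
        (1 / (4 * (h : ℝ) * (2 * h + 1))) *
          Real.log ‖delta h α i k * (delta h α j k)⁻¹ * delta h α j r * (delta h α i r)⁻¹‖)
    (hrow : ∀ i j : Fin (2 * h + 2),
      ∑ k ∈ Finset.univ.filter (fun k => k ≠ i), G i k =
        ∑ k ∈ Finset.univ.filter (fun k => k ≠ j), G j k)
    (ψ : ℝ)
    (hψ : ψ = (1 / (2 * (h : ℝ) + 2)) *
      ∑ i : Fin (2 * h + 2), ∑ j ∈ Finset.univ.filter (fun j => j ≠ i), G i j)
    (i j : Fin (2 * h + 2)) (hij : i ≠ j) :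
    G i j = (1 / (4 * (h : ℝ) * (2 * h + 1))) * Real.log ‖delta h α i j‖ +
      (1 / (2 * (h : ℝ) + 1)) * ψ := by
  set c : ℝ := 1 / (4 * (h : ℝ) * (2 * h + 1))
  have hψrow (k : Fin (2 * h + 2)) : ∑ l ∈ univ.filter (fun l => l ≠ k), G k l = ψ := by
    rw [hψ, sum_congr rfl fun l _ => hrow l k, sum_const, card_univ, Fintype.card_fin,
      nsmul_eq_mul]
    push_cast
    field_simp
  have key := card_sub_one_mul_eq_of_second_difference_eq_zero
    (fun k l => G k l - c * Real.log ‖delta h α k l‖) ψ (by rw [Fintype.card_fin]; lia)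
    (fun k l hkl => by rw [hsym k l hkl, log_norm_delta_comm h α hα k l hkl])
    (fun a b k r hab hak har hbk hbr hkr => by
      have hδ {p q : Fin (2 * h + 2)} (hpq : p ≠ q) : ‖delta h α p q‖ ≠ 0 :=
        norm_ne_zero_iff.mpr (delta_ne_zero h α hα p q hpq)
      have hG := hcross a b k r hab hak har hbk hbr hkr
      rw [norm_mul, norm_mul, norm_mul, norm_inv, norm_inv,
        Real.log_mul (mul_ne_zero (mul_ne_zero (hδ hak) (inv_ne_zero (hδ hbk))) (hδ hbr))
          (inv_ne_zero (hδ har)),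
        Real.log_mul (mul_ne_zero (hδ hak) (inv_ne_zero (hδ hbk))) (hδ hbr),
        Real.log_mul (hδ hak) (inv_ne_zero (hδ hbk)), Real.log_inv, Real.log_inv] at hG
      linear_combination hG)
    (fun k => by
      rw [sum_sub_distrib, ← mul_sum, sum_log_norm_delta h α hα, mul_zero, sub_zero, hψrow])
    i j hij
  rw [Fintype.card_fin] at key
  push_cast at key
  have hpos : (2 * (h : ℝ) + 1) ≠ 0 := by positivity
  field_simp
  linear_combination key
end

section
/- Let ω₁, ω₂ be complex numbers that are linearly independent over ℝ, and let Λ = ℤω₁ + ℤω₂ be the lattice they generate. Let N ≥ 1 be an integer and let g : ℂ × ℂ → ℝ be a function satisfying: (a) g(x + λ, y) = g(x, y) = g(x, y + λ) for all x, y ∈ ℂ and λ ∈ Λ (Λ-periodicity in each variable); (b) g(x, y) = g(y, x) for all x, y (symmetry); (c) for all x, y ∈ ℂ with N·x − y ∉ Λ one has g(N·x, y) = ∑_{i=0}^{N−1} ∑_{j=0}^{N−1} g(x, y/N + (i·ω₁ + j·ω₂)/N) (distribution relation); (d) there exists a real number a such that g(x, 0) − log ‖x‖ tends to a as x tends to 0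 through nonzero values (logarithmic singularity); (e) for every x₀ ∈ ℂ with x₀ ∉ Λ, the function y ↦ g(x₀, y) is continuous at y = 0. Then ∑ g((i·ω₁ + j·ω₂)/N, 0) = log N, where the sum runs over all pairs (i, j) with 0 ≤ i, j ≤ N−1 and (i, j) ≠ (0, 0). (This is the content of Proposition 2.1: on a complex torus (M, o) = ℂ/Λ, the canonical Green's function g_μ satisfies hypotheses (a)–(e), and the sum of its values g_μ(x_i, o) over the N² − 1 non-trivial N-torsion points x_i equals log N.) -/
open Finset Filter

/-- Coordinates with respect to an `ℝ`-basis of `ℂ` are continuous linear functionals. -/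
theorem exists_coord_of_linearIndependent {ω₁ ω₂ : ℂ}
    (hindep : LinearIndependent ℝ ![ω₁, ω₂]) :
    ∃ c d : ℂ →L[ℝ] ℝ, ∀ s t : ℝ,
      c ((s : ℂ) * ω₁ + (t : ℂ) * ω₂) = s ∧ d ((s : ℂ) * ω₁ + (t : ℂ) * ω₂) = t := by
  let b := basisOfLinearIndependentOfCardEqFinrank hindep (by simp [Complex.finrank_real_complex])
  have h₁ : b 0 = ω₁ := by simp [b]
  have h₂ : b 1 = ω₂ := by simp [b]
  refine ⟨(b.coord 0).toContinuousLinearMap, (b.coord 1).toContinuousLinearMap, fun s t => ?_⟩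
  have h : (s : ℂ) * ω₁ + (t : ℂ) * ω₂ = s • b 0 + t • b 1 := by
    rw [h₁, h₂, Complex.real_smul, Complex.real_smul]
  rw [h]
  constructor <;> simp [-Complex.real_smul]

/-- A full lattice in `ℂ` has no nonzero points near the origin. -/
theorem eventually_notMem_lattice {ω₁ ω₂ : ℂ} (hindep : LinearIndependent ℝ ![ω₁, ω₂]) :
    ∀ᶠ z : ℂ in nhdsWithin 0 {(0 : ℂ)}ᶜ,
      ¬ ∃ m n : ℤ, z = (m : ℂ) * ω₁ + (n : ℂ) * ω₂ := by
  obtain ⟨c, d, hcd⟩ := exists_coord_of_linearIndependent hindep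
  have small : ∀ f : ℂ →L[ℝ] ℝ, ∀ᶠ z : ℂ in nhdsWithin 0 {(0 : ℂ)}ᶜ, |f z| < 1 := by
    intro f
    refine nhdsWithin_le_nhds ?_
    have hf : Tendsto (fun z => |f z|) (nhds 0) (nhds |f 0|) := f.continuous.abs.tendsto 0
    exact hf.eventually_lt_const (by simp)
  filter_upwards [small c, small d, self_mem_nhdsWithin] with z hc hd hz
  rintro ⟨m, n, rfl⟩
  have h := hcd m n
  push_cast at h
  rw [h.1] at hc
  rw [h.2] at hd
  have hm : m = 0 := Int.abs_lt_one_iff.mp (by exact_mod_cast hc)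
  have hn : n = 0 := Int.abs_lt_one_iff.mp (by exact_mod_cast hd)
  simp [hm, hn] at hz

/-- A nontrivial reduced `N`-division point does not lie in the lattice. -/
theorem torsion_point_notMem_lattice {ω₁ ω₂ : ℂ} (hindep : LinearIndependent ℝ ![ω₁, ω₂])
    {N i j : ℕ} (hi : i < N) (hj : j < N) (hij : (i, j) ≠ (0, 0)) :
    ¬ ∃ m n : ℤ, ((i : ℂ) * ω₁ + (j : ℂ) * ω₂) / (N : ℂ) = (m : ℂ) * ω₁ + (n : ℂ) * ω₂ := by
  obtain ⟨c, d, hcd⟩ := exists_coord_of_linearIndependent hindep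
  rintro ⟨m, n, h⟩
  have hN : (N : ℂ) ≠ 0 := by exact_mod_cast (by omega : N ≠ 0)
  have h' : ((i : ℝ) : ℂ) * ω₁ + ((j : ℝ) : ℂ) * ω₂ =
      ((N * m : ℝ) : ℂ) * ω₁ + ((N * n : ℝ) : ℂ) * ω₂ := by
    rw [div_eq_iff hN] at h
    push_cast
    rw [h]
    ring
  have hc := congrArg c h'
  have hd := congrArg d h'
  rw [(hcd _ _).1, (hcd _ _).1] at hc
  rw [(hcd _ _).2, (hcd _ _).2] at hd
  have hi' : i = 0 := by
    have e : (i : ℤ) = N * m := by exact_mod_cast hc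
    exact Nat.eq_zero_of_dvd_of_lt (Int.natCast_dvd_natCast.mp ⟨m, e⟩) hi
  have hj' : j = 0 := by
    have e : (j : ℤ) = N * n := by exact_mod_cast hd
    exact Nat.eq_zero_of_dvd_of_lt (Int.natCast_dvd_natCast.mp ⟨n, e⟩) hj
  exact hij (by rw [hi', hj'])

/-- Proposition 2.1 (abstract form): let `Λ = ℤω₁ + ℤω₂` be a lattice in `ℂ` and let `g`
be a symmetric, `Λ`-biperiodic function satisfying the distribution relation for
multiplication by `N`, with a logarithmic singularity along the diagonal and continuity
off the diagonal. Then the sum of `g(x, 0)` over the `N² − 1` nontrivial `N`-torsion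
points `x` of `ℂ/Λ` equals `log N`. -/
theorem sum_green_torsion (ω₁ ω₂ : ℂ) (hindep : LinearIndependent ℝ ![ω₁, ω₂])
    (N : ℕ) (hN : 1 ≤ N) (g : ℂ → ℂ → ℝ)
    (hper : ∀ (x y : ℂ) (m n : ℤ),
      g (x + ((m : ℂ) * ω₁ + (n : ℂ) * ω₂)) y = g x y ∧
        g x (y + ((m : ℂ) * ω₁ + (n : ℂ) * ω₂)) = g x y)
    (hsym : ∀ x y : ℂ, g x y = g y x)
    (hdist : ∀ x y : ℂ, (¬ ∃ m n : ℤ, (N : ℂ) * x - y = (m : ℂ) * ω₁ + (n : ℂ) * ω₂) →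
      g ((N : ℂ) * x) y =
        ∑ i ∈ Finset.range N, ∑ j ∈ Finset.range N,
          g x (y / (N : ℂ) + ((i : ℂ) * ω₁ + (j : ℂ) * ω₂) / (N : ℂ)))
    (hlog : ∃ a : ℝ,
      Tendsto (fun x : ℂ => g x 0 - Real.log ‖x‖) (nhdsWithin 0 {(0 : ℂ)}ᶜ) (nhds a))
    (hcont : ∀ x₀ : ℂ, (¬ ∃ m n : ℤ, x₀ = (m : ℂ) * ω₁ + (n : ℂ) * ω₂) →
      ContinuousAt (fun y => g x₀ y) 0) :
    ∑ p ∈ (Finset.range N ×ˢ Finset.range N).filter (fun p => p ≠ (0, 0)),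
        g (((p.1 : ℂ) * ω₁ + (p.2 : ℂ) * ω₂) / (N : ℂ)) 0 = Real.log N := by
  obtain ⟨a, ha⟩ := hlog
  have hN₀ : (N : ℂ) ≠ 0 := by exact_mod_cast (by omega : N ≠ 0)
  set S := (Finset.range N ×ˢ Finset.range N).filter (fun p => p ≠ (0, 0)) with hS
  have hmul : Tendsto (fun x : ℂ => (N : ℂ) * x) (nhdsWithin 0 {(0 : ℂ)}ᶜ)
      (nhdsWithin 0 {(0 : ℂ)}ᶜ) := by
    refine tendsto_nhdsWithin_iff.mpr ⟨?_, ?_⟩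
    · have h : Tendsto (fun x : ℂ => (N : ℂ) * x) (nhds 0) (nhds ((N : ℂ) * 0)) :=
        (continuous_const_mul (N : ℂ)).tendsto 0
      rw [mul_zero] at h
      exact h.mono_left nhdsWithin_le_nhds
    · filter_upwards [self_mem_nhdsWithin] with x hx
      exact mul_ne_zero hN₀ hx
  have hlim : Tendsto (fun x : ℂ => ∑ p ∈ S, g x (((p.1 : ℂ) * ω₁ + (p.2 : ℂ) * ω₂) / (N : ℂ)))
      (nhdsWithin 0 {(0 : ℂ)}ᶜ)
      (nhds (∑ p ∈ S, g (((p.1 : ℂ) * ω₁ + (p.2 : ℂ) * ω₂) / (N : ℂ)) 0)) := by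
    refine tendsto_finsetSum _ fun p hp => ?_
    simp only [hS, Finset.mem_filter, Finset.mem_product, Finset.mem_range] at hp
    have h := hcont _ (torsion_point_notMem_lattice hindep hp.1.1 hp.1.2 hp.2)
    simp only [hsym _ (((p.1 : ℂ) * ω₁ + (p.2 : ℂ) * ω₂) / (N : ℂ))]
    exact Tendsto.mono_left h nhdsWithin_le_nhds
  have hlim' : Tendsto (fun x : ℂ => ∑ p ∈ S, g x (((p.1 : ℂ) * ω₁ + (p.2 : ℂ) * ω₂) / (N : ℂ)))
      (nhdsWithin 0 {(0 : ℂ)}ᶜ) (nhds (Real.log N)) := by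
    have h := ((ha.comp hmul).sub ha).add_const (Real.log N)
    rw [sub_self, zero_add] at h
    refine h.congr' ?_
    filter_upwards [hmul.eventually (eventually_notMem_lattice hindep), self_mem_nhdsWithin]
      with x hx hx₀
    have hd := hdist x 0 (by rwa [sub_zero])
    simp only [zero_div, zero_add] at hd
    rw [← Finset.sum_product', ← Finset.sum_filter_add_sum_filter_not _ (fun p => p ≠ (0, 0)),
      ← hS] at hd
    have hzero : (Finset.range N ×ˢ Finset.range N).filter (fun p => ¬ p ≠ (0, 0)) =
        {(0, 0)} := by
      ext p
      simp only [Finset.mem_filter, Finset.mem_product, Finset.mem_range, not_not,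
        Finset.mem_singleton]
      refine ⟨fun h => h.2, fun h => ⟨?_, h⟩⟩
      subst h
      exact ⟨hN, hN⟩
    rw [hzero, Finset.sum_singleton] at hd
    simp only [Nat.cast_zero, zero_mul, add_zero, zero_div] at hd
    have hlogN : Real.log ‖(N : ℂ) * x‖ = Real.log N + Real.log ‖x‖ := by
      rw [norm_mul, Complex.norm_natCast,
        Real.log_mul (by exact_mod_cast hN₀) (norm_ne_zero_iff.mpr hx₀)]
    simp only [Function.comp_apply]
    rw [hd, hlogN]
    ring
  exact tendsto_nhds_unique hlim hlim'
end

section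
/- Let h₁, h₂ ≥ 1 be integers and set h = h₁ + h₂. Let S₁ be an index set with 2h₁+2 elements with a distinguished element p₁, and S₂ an index set with 2h₂+2 elements with a distinguished element p₂; put I₁ = S₁ \ {p₁} and I₂ = S₂ \ {p₂}. Let G₁ be a symmetric real-valued function on pairs of distinct indices of S₁ whose row sums ∑_{k≠i} G₁(i,k) are equal for all i ∈ S₁, and define ψ₁ = (1/(2h₁+2)) ∑_{i≠j} G₁(i,j); let G₂ and ψ₂ be defined analogously on S₂. Let F be a filter on some index type, let L be a real-valued function on that type, and for each index t let A_t be a symmetric real-valued function on pairs of distinct elements of the disjoint union I₁ ⊔ I₂. Assume: (i) for all distinct i, j ∈ I₁, the function t ↦ A_t(i,j) − (h₂/h)²·L(t) tends along F to G₁(i,j) − (h₂/h)·(G₁(i,p₁) + G₁(j,p₁)); (ii) for all distinct i, j ∈ I₂, the function t ↦ A_t(i,j) − (h₁/h)²·L(t) tends along F to G₂(i,j) − (h₁/h)·(G₂(i,p₂) + G₂(j,p₂)); (iii) for all i ∈ I₁ and j ∈ I₂, the function t ↦ A_t(i,j) + (h₁h₂/h²)·L(t) tends along F to (h₁/h)·G₁(i,p₁)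 + (h₂/h)·G₂(j,p₂). Then the function t ↦ (1/(2h+2)) ∑_{x≠y} A_t(x,y) + (h₁h₂/h²)·L(t), where the sum runs over all ordered pairs of distinct elements of I₁ ⊔ I₂, tends along F to (h₁/h)·ψ₁ + (h₂/h)·ψ₂. (This is the content of Theorem 4.4 given the degeneration asymptotics of Theorem 4.6: for a family M_t of hyperelliptic Riemann surfaces of genus h degenerating into the union of two hyperelliptic surfaces M₁, M₂ of genera h₁, h₂ glued at Weierstrass points p₁, p₂, with A_t the canonical Green's function of M_t evaluated at pairs of Weierstrass points, G₁, G₂ the canonical Green's functions of M₁, M₂ at their Weierstrass points, and L(t) = log|τ|, the conclusion reads lim_{t→0} [ψ(M_t) + (h₁h₂/h²) log|τ|] = (h₁/h)ψ(M₁) + (h₂/h)ψ(M₂).) -/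
open Finset Filter

section EqualRowSums

variable {ι : Type*} [Fintype ι] [DecidableEq ι] {G : ι → ι → ℝ} {R : ℝ}

lemma sum_erase_apply_right (hsym : ∀ i j, i ≠ j → G i j = G j i)
    (hrow : ∀ i, ∑ k ∈ univ.erase i, G i k = R) (p : ι) :
    ∑ i ∈ univ.erase p, G i p = R := by
  rw [← hrow p]
  exact sum_congr rfl fun i hi => hsym i p (ne_of_mem_erase hi)

lemma sum_erase_erase (hrow : ∀ i, ∑ k ∈ univ.erase i, G i k = R) {i p : ι} (hi : i ≠ p) :
    ∑ j ∈ (univ.erase p).erase i, G i j = R - G i p := by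
  rw [erase_right_comm, sum_erase_eq_sub (mem_erase.2 ⟨hi.symm, mem_univ p⟩), hrow]

lemma cast_card_univ_erase (p : ι) :
    ((univ.erase p).card : ℝ) = Fintype.card ι - 1 := by
  rw [cast_card_erase_of_mem (mem_univ p), card_univ]

lemma cast_card_univ_erase_erase {i p : ι} (hi : i ∈ univ.erase p) :
    (((univ.erase p).erase i).card : ℝ) = Fintype.card ι - 2 := by
  rw [cast_card_erase_of_mem hi, cast_card_univ_erase]
  ring

/-- The sum of `G i j - c (G i p + G j p)` over the ordered pairs of distinct indices
different from `p`. -/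
lemma sum_offDiag_erase (hsym : ∀ i j, i ≠ j → G i j = G j i)
    (hrow : ∀ i, ∑ k ∈ univ.erase i, G i k = R) (p : ι) (c : ℝ) :
    ∑ i ∈ univ.erase p, ∑ j ∈ (univ.erase p).erase i, (G i j - c * (G i p + G j p)) =
      (Fintype.card ι - 2) * (1 - 2 * c) * R := by
  have hcol := sum_erase_apply_right hsym hrow p
  have hinner : ∀ i ∈ univ.erase p,
      ∑ j ∈ (univ.erase p).erase i, (G i j - c * (G i p + G j p)) =
        (1 - c) * R - (1 + c * (Fintype.card ι - 3)) * G i p := by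
    intro i hi
    rw [sum_sub_distrib, ← mul_sum, sum_add_distrib, sum_const, nsmul_eq_mul,
      cast_card_univ_erase_erase hi, sum_erase_erase hrow (ne_of_mem_erase hi),
      sum_erase_eq_sub hi, hcol]
    ring
  rw [sum_congr rfl hinner, sum_sub_distrib, sum_const, nsmul_eq_mul, ← mul_sum, hcol,
    cast_card_univ_erase]
  ring

lemma tendsto_sum_offDiag_erase (hsym : ∀ i j, i ≠ j → G i j = G j i)
    (hrow : ∀ i, ∑ k ∈ univ.erase i, G i k = R) {p : ι} {a c : ℝ}
    {T : Type*} {F : Filter T} {L : T → ℝ} {B : T → ι → ι → ℝ}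
    (hlim : ∀ i j, i ≠ p → j ≠ p → i ≠ j →
      Tendsto (fun t => B t i j - a * L t) F (nhds (G i j - c * (G i p + G j p)))) :
    Tendsto (fun t => ∑ i ∈ univ.erase p, ∑ j ∈ (univ.erase p).erase i, B t i j -
        (Fintype.card ι - 1) * (Fintype.card ι - 2) * a * L t) F
      (nhds ((Fintype.card ι - 2) * (1 - 2 * c) * R)) := by
  rw [← sum_offDiag_erase hsym hrow p c]
  have key := tendsto_finsetSum (univ.erase p) fun i hi =>
    tendsto_finsetSum ((univ.erase p).erase i) fun j hj =>
      hlim i j (ne_of_mem_erase hi) (ne_of_mem_erase (mem_of_mem_erase hj))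
        (ne_of_mem_erase hj).symm
  refine key.congr fun t => ?_
  have hinner : ∀ i ∈ univ.erase p, ∑ j ∈ (univ.erase p).erase i, (B t i j - a * L t) =
      ∑ j ∈ (univ.erase p).erase i, B t i j - (Fintype.card ι - 2) * (a * L t) := by
    intro i hi
    rw [sum_sub_distrib, sum_const, nsmul_eq_mul, cast_card_univ_erase_erase hi]
  rw [sum_congr rfl hinner, sum_sub_distrib, sum_const, nsmul_eq_mul, cast_card_univ_erase]
  ring

lemma tendsto_sum_erase_cross {κ : Type*} [Fintype κ] [DecidableEq κ] {G' : κ → κ → ℝ} {R' : ℝ}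
    (hsym : ∀ i j, i ≠ j → G i j = G j i) (hrow : ∀ i, ∑ k ∈ univ.erase i, G i k = R)
    (hsym' : ∀ i j, i ≠ j → G' i j = G' j i) (hrow' : ∀ i, ∑ k ∈ univ.erase i, G' i k = R')
    {p : ι} {q : κ} {a c d : ℝ}
    {T : Type*} {F : Filter T} {L : T → ℝ} {B : T → ι → κ → ℝ}
    (hlim : ∀ i j, i ≠ p → j ≠ q →
      Tendsto (fun t => B t i j + a * L t) F (nhds (c * G i p + d * G' j q))) :
    Tendsto (fun t => ∑ i ∈ univ.erase p, ∑ j ∈ univ.erase q, B t i j +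
        (Fintype.card ι - 1) * (Fintype.card κ - 1) * a * L t) F
      (nhds ((Fintype.card κ - 1) * c * R + (Fintype.card ι - 1) * d * R')) := by
  have key := tendsto_finsetSum (univ.erase p) fun i hi =>
    tendsto_finsetSum (univ.erase q) fun j hj =>
      hlim i j (ne_of_mem_erase hi) (ne_of_mem_erase hj)
  simp only [sum_add_distrib, sum_const, nsmul_eq_mul, cast_card_univ_erase, ← mul_sum,
    sum_erase_apply_right hsym hrow, sum_erase_apply_right hsym' hrow'] at key
  convert key using 2 <;> ring

/-- If all row sums agree, each equals the normalized total sum. -/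
lemma row_sum_eq_average [Nonempty ι]
    (hrow : ∀ i j, ∑ k ∈ univ.erase i, G i k = ∑ k ∈ univ.erase j, G j k) (i : ι) :
    ∑ k ∈ univ.erase i, G i k =
      1 / (Fintype.card ι : ℝ) * ∑ j, ∑ k ∈ univ.erase j, G j k := by
  rw [sum_congr rfl fun j _ => hrow j i, sum_const, nsmul_eq_mul, card_univ]
  have : (Fintype.card ι : ℝ) ≠ 0 := Nat.cast_ne_zero.2 Fintype.card_ne_zero
  field_simp

end EqualRowSums

/-- The sum over ordered pairs of distinct elements of `(ι \ {p}) ⊔ (κ \ {q})`, split into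
its diagonal and cross parts. -/
lemma sum_sumType_offDiag_erase {ι κ : Type*} [Fintype ι] [DecidableEq ι] [Fintype κ]
    [DecidableEq κ] (p : ι) (q : κ) {B : ι ⊕ κ → ι ⊕ κ → ℝ} (hB : ∀ x y, B x y = B y x) :
    ∑ x ∈ univ.filter (fun x : ι ⊕ κ => x ≠ Sum.inl p ∧ x ≠ Sum.inr q),
      ∑ y ∈ univ.filter (fun y : ι ⊕ κ => (y ≠ Sum.inl p ∧ y ≠ Sum.inr q) ∧ y ≠ x), B x y =
    ∑ i ∈ univ.erase p, ∑ j ∈ (univ.erase p).erase i, B (Sum.inl i) (Sum.inl j) +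
      ∑ i ∈ univ.erase q, ∑ j ∈ (univ.erase q).erase i, B (Sum.inr i) (Sum.inr j) +
      2 * ∑ i ∈ univ.erase p, ∑ j ∈ univ.erase q, B (Sum.inl i) (Sum.inr j) := by
  have hset : univ.filter (fun x : ι ⊕ κ => x ≠ Sum.inl p ∧ x ≠ Sum.inr q) =
      (univ.erase p).disjSum (univ.erase q) := by
    ext (x | x) <;> simp
  have hinl : ∀ i, univ.filter
      (fun y : ι ⊕ κ => (y ≠ Sum.inl p ∧ y ≠ Sum.inr q) ∧ y ≠ Sum.inl i) =
      ((univ.erase p).erase i).disjSum (univ.erase q) := by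
    intro i
    ext (x | x) <;> simp [and_comm]
  have hinr : ∀ i, univ.filter
      (fun y : ι ⊕ κ => (y ≠ Sum.inl p ∧ y ≠ Sum.inr q) ∧ y ≠ Sum.inr i) =
      (univ.erase p).disjSum ((univ.erase q).erase i) := by
    intro i
    ext (x | x) <;> simp [and_comm]
  have hcross : ∑ i ∈ univ.erase q, ∑ j ∈ univ.erase p, B (Sum.inr i) (Sum.inl j) =
      ∑ i ∈ univ.erase p, ∑ j ∈ univ.erase q, B (Sum.inl i) (Sum.inr j) := by
    rw [sum_comm]
    exact sum_congr rfl fun i _ => sum_congr rfl fun j _ => hB _ _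
  simp only [hset, sum_disjSum, hinl, hinr, sum_add_distrib, hcross]
  ring

/-- Theorem 4.4 (abstract form): given Wentworth's asymptotics (i), (ii), (iii) for the
values `A_t` of the Green's functions of a degenerating family at pairs of Weierstrass
points, the normalized energy `(1/(2h+2)) ∑_{x≠y} A_t(x,y) + (h₁h₂/h²) L(t)` tends to
`(h₁/h) ψ₁ + (h₂/h) ψ₂`. -/
theorem theorem44 (h₁ h₂ : ℕ) (hh₁ : 1 ≤ h₁) (hh₂ : 1 ≤ h₂) (h : ℕ) (hh : h = h₁ + h₂)
    (p₁ : Fin (2 * h₁ + 2)) (p₂ : Fin (2 * h₂ + 2))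
    (G₁ : Fin (2 * h₁ + 2) → Fin (2 * h₁ + 2) → ℝ)
    (G₂ : Fin (2 * h₂ + 2) → Fin (2 * h₂ + 2) → ℝ)
    (hsym₁ : ∀ i j, i ≠ j → G₁ i j = G₁ j i)
    (hsym₂ : ∀ i j, i ≠ j → G₂ i j = G₂ j i)
    (hrow₁ : ∀ i j : Fin (2 * h₁ + 2),
      ∑ k ∈ Finset.univ.filter (fun k => k ≠ i), G₁ i k =
        ∑ k ∈ Finset.univ.filter (fun k => k ≠ j), G₁ j k)
    (hrow₂ : ∀ i j : Fin (2 * h₂ + 2),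
      ∑ k ∈ Finset.univ.filter (fun k => k ≠ i), G₂ i k =
        ∑ k ∈ Finset.univ.filter (fun k => k ≠ j), G₂ j k)
    (ψ₁ : ℝ) (hψ₁ : ψ₁ = (1 / (2 * (h₁ : ℝ) + 2)) *
      ∑ i : Fin (2 * h₁ + 2), ∑ j ∈ Finset.univ.filter (fun j => j ≠ i), G₁ i j)
    (ψ₂ : ℝ) (hψ₂ : ψ₂ = (1 / (2 * (h₂ : ℝ) + 2)) *
      ∑ i : Fin (2 * h₂ + 2), ∑ j ∈ Finset.univ.filter (fun j => j ≠ i), G₂ i j)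
    (T : Type*) (F : Filter T) (L : T → ℝ)
    (A : T → (Fin (2 * h₁ + 2) ⊕ Fin (2 * h₂ + 2)) →
      (Fin (2 * h₁ + 2) ⊕ Fin (2 * h₂ + 2)) → ℝ)
    (hAsym : ∀ t x y, A t x y = A t y x)
    (hlim₁ : ∀ i j : Fin (2 * h₁ + 2), i ≠ p₁ → j ≠ p₁ → i ≠ j →
      Tendsto (fun t => A t (Sum.inl i) (Sum.inl j) - ((h₂ : ℝ) / h) ^ 2 * L t) F
        (nhds (G₁ i j - ((h₂ : ℝ) / h) * (G₁ i p₁ + G₁ j p₁))))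
    (hlim₂ : ∀ i j : Fin (2 * h₂ + 2), i ≠ p₂ → j ≠ p₂ → i ≠ j →
      Tendsto (fun t => A t (Sum.inr i) (Sum.inr j) - ((h₁ : ℝ) / h) ^ 2 * L t) F
        (nhds (G₂ i j - ((h₁ : ℝ) / h) * (G₂ i p₂ + G₂ j p₂))))
    (hlim₃ : ∀ (i : Fin (2 * h₁ + 2)) (j : Fin (2 * h₂ + 2)), i ≠ p₁ → j ≠ p₂ →
      Tendsto (fun t => A t (Sum.inl i) (Sum.inr j) + ((h₁ : ℝ) * h₂ / (h : ℝ) ^ 2) * L t) F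
        (nhds (((h₁ : ℝ) / h) * G₁ i p₁ + ((h₂ : ℝ) / h) * G₂ j p₂))) :
    Tendsto (fun t => (1 / (2 * (h : ℝ) + 2)) *
        (∑ x ∈ Finset.univ.filter
            (fun x : Fin (2 * h₁ + 2) ⊕ Fin (2 * h₂ + 2) =>
              x ≠ Sum.inl p₁ ∧ x ≠ Sum.inr p₂),
          ∑ y ∈ Finset.univ.filter
            (fun y : Fin (2 * h₁ + 2) ⊕ Fin (2 * h₂ + 2) =>
              (y ≠ Sum.inl p₁ ∧ y ≠ Sum.inr p₂) ∧ y ≠ x),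
            A t x y) + ((h₁ : ℝ) * h₂ / (h : ℝ) ^ 2) * L t) F
      (nhds (((h₁ : ℝ) / h) * ψ₁ + ((h₂ : ℝ) / h) * ψ₂)) := by
  simp only [filter_ne'] at hrow₁ hrow₂ hψ₁ hψ₂
  have hR₁ : ∀ i, ∑ k ∈ univ.erase i, G₁ i k = ψ₁ := fun i => by
    rw [row_sum_eq_average hrow₁ i, hψ₁, Fintype.card_fin]
    push_cast
    rfl
  have hR₂ : ∀ i, ∑ k ∈ univ.erase i, G₂ i k = ψ₂ := fun i => by
    rw [row_sum_eq_average hrow₂ i, hψ₂, Fintype.card_fin]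
    push_cast
    rfl
  have hlim := (((tendsto_sum_offDiag_erase hsym₁ hR₁ hlim₁).add
    (tendsto_sum_offDiag_erase hsym₂ hR₂ hlim₂)).add
    ((tendsto_sum_erase_cross hsym₁ hR₁ hsym₂ hR₂ hlim₃).const_mul 2)).const_mul
      (1 / (2 * (h : ℝ) + 2))
  simp only [Fintype.card_fin] at hlim
  have hpos₁ : (0 : ℝ) < h₁ := Nat.cast_pos.2 hh₁
  have hpos₂ : (0 : ℝ) < h₂ := Nat.cast_pos.2 hh₂
  subst hh
  push_cast at hlim ⊢
  convert hlim using 2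
  · rw [sum_sumType_offDiag_erase p₁ p₂ (hAsym _)]
    field_simp
    ring
  · field_simp
    ring
end
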